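/- Let X, Y, Z be compacta. If R ⊆ exp X × exp Y and S ⊆ exp Y × exp Z are open ambiguous representations, then their relational composition R ∘ S = {(A,C) : ∃B ∈ exp Y, (A,B) ∈ R, (B,C) ∈ S} is an open ambiguous representation between X and Z. -/

import Mathlib

open Set Topology

/-- The hyperspace `exp X` of all nonempty closed subsets of `X`. -/
structure Exp (X : Type*) [TopologicalSpace X] where
  carrier : Set X
  isClosed' : IsClosed carrier
  nonempty' : carrier.Nonempty

namespace Exp

variable {X : Type*} [TopologicalSpace X]

/-- The Vietoris topology on `exp X`, generated by the subbase consisting of the sets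
`⟨U⟩ = {F | F ⊆ U}` and `⟨X, U⟩ = {F | F ∩ U ≠ ∅}` for open `U ⊆ X`. -/
instance topologicalSpace : TopologicalSpace (Exp X) :=
  TopologicalSpace.generateFrom
    ({S | ∃ U : Set X, IsOpen U ∧ S = {F : Exp X | F.carrier ⊆ U}} ∪
     {S | ∃ U : Set X, IsOpen U ∧ S = {F : Exp X | (F.carrier ∩ U).Nonempty}})

/-- The whole space `X` as an element of `exp X`. -/
def univ (X : Type*) [TopologicalSpace X] [Nonempty X] : Exp X :=
  ⟨Set.univ, isClosed_univ, Set.univ_nonempty⟩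

/-- Union of two elements of `exp X`. -/
def union (F G : Exp X) : Exp X :=
  ⟨F.carrier ∪ G.carrier, F.isClosed'.union G.isClosed',
    Set.union_nonempty.mpr (Or.inl F.nonempty')⟩

end Exp

section AmbiguousRepresentations

variable {X Y Z : Type*} [TopologicalSpace X] [TopologicalSpace Y] [TopologicalSpace Z]

/-- An ambiguous representation between `X` and `Y`:
(a) antitone in the first argument and isotone in the second;
(b) `(A, Y) ∈ R` for all `A`;
(c) all sets `AR = {B | (A,B) ∈ R}` are closed in the Vietoris topology. -/
def IsAmbRep [Nonempty Y] (R : Set (Exp X × Exp Y)) : Prop :=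
  (∀ (A A' : Exp X) (B B' : Exp Y),
      (A, B) ∈ R → A'.carrier ⊆ A.carrier → B.carrier ⊆ B'.carrier → (A', B') ∈ R) ∧
  (∀ A : Exp X, (A, Exp.univ Y) ∈ R) ∧
  (∀ A : Exp X, IsClosed {B : Exp Y | (A, B) ∈ R})

/-- The relation `R^⊣ ⊆ exp Y × exp X`: `(B̃, Ã) ∈ R^⊣` iff for every `A ∈ exp X` with
`A ∩ Ã = ∅` there exists `B ∈ AR` with `B ∩ B̃ = ∅`. -/
def sms (R : Set (Exp X × Exp Y)) : Set (Exp Y × Exp X) :=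
  {p | ∀ A : Exp X, A.carrier ∩ p.2.carrier = ∅ →
      ∃ B : Exp Y, (A, B) ∈ R ∧ B.carrier ∩ p.1.carrier = ∅}

/-- A strict ambiguous representation: additionally all sets `RB = {A | (A,B) ∈ R}`
are closed. -/
def IsStrictAmbRep [Nonempty Y] (R : Set (Exp X × Exp Y)) : Prop :=
  IsAmbRep R ∧ ∀ B : Exp Y, IsClosed {A : Exp X | (A, B) ∈ R}

/-- An open ambiguous representation: strict, pseudo-invertible, and `R^⊣` is strict. -/
def IsOpenAmbRep [Nonempty X] [Nonempty Y] (R : Set (Exp X × Exp Y)) : Prop :=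
  IsStrictAmbRep R ∧ sms (sms R) = R ∧ IsStrictAmbRep (sms R)

/-- The composition `R ⊚ S`: `A (R ⊚ S)` is the closure of
`{C | ∃ B, (A,B) ∈ R ∧ (B,C) ∈ S}`. -/
def bcomp (R : Set (Exp X × Exp Y)) (S : Set (Exp Y × Exp Z)) : Set (Exp X × Exp Z) :=
  {p | p.2 ∈ closure {C : Exp Z | ∃ B : Exp Y, (p.1, B) ∈ R ∧ (B, C) ∈ S}}

/-- The relational composition of `R` and `S`. -/
def rcomp (R : Set (Exp X × Exp Y)) (S : Set (Exp Y × Exp Z)) : Set (Exp X × Exp Z) :=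
  {p | ∃ B : Exp Y, (p.1, B) ∈ R ∧ (B, p.2) ∈ S}

end AmbiguousRepresentations

namespace Exp

variable {X : Type*} [TopologicalSpace X]

lemma isOpen_subset {U : Set X} (hU : IsOpen U) : IsOpen {F : Exp X | F.carrier ⊆ U} :=
  TopologicalSpace.isOpen_generateFrom_of_mem (Or.inl ⟨U, hU, rfl⟩)

/-- The hyperspace of a compact space is compact: an ultrafilter converges to the set of points
all of whose open neighbourhoods are hit by almost all of its members. -/
instance compactSpace [CompactSpace X] : CompactSpace (Exp X) where
  isCompact_univ := by
    rw [isCompact_iff_ultrafilter_le_nhds]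
    intro f _
    let L : Set X := {x | ∀ U : Set X, IsOpen U → x ∈ U →
      ∀ᶠ F : Exp X in (f : Filter (Exp X)), (F.carrier ∩ U).Nonempty}
    have hLc : IsClosed L := by
      rw [← isOpen_compl_iff, isOpen_iff_forall_mem_open]
      intro x hx
      simp only [L, mem_compl_iff, mem_ofPred_eq, not_forall] at hx
      obtain ⟨U, hU, hxU, h⟩ := hx
      exact ⟨U, fun y hy hyL => h (hyL U hU hy), hU, hxU⟩
    have hsub : ∀ U : Set X, IsOpen U → L ⊆ U →
        ∀ᶠ F : Exp X in (f : Filter (Exp X)), F.carrier ⊆ U := by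
      intro U hU hLU
      have key : ∀ᶠ F : Exp X in (f : Filter (Exp X)), F.carrier ∩ Uᶜ = ∅ := by
        refine (hU.isClosed_compl.isCompact).induction_on
          (p := fun s => ∀ᶠ F : Exp X in (f : Filter (Exp X)), F.carrier ∩ s = ∅) ?_ ?_ ?_ ?_
        · simp
        · intro s t hst ht
          filter_upwards [ht] with F hF
          exact subset_empty_iff.1 (hF ▸ inter_subset_inter_right _ hst)
        · intro s t hs ht
          filter_upwards [hs, ht] with F h1 h2
          rw [inter_union_distrib_left, h1, h2, union_empty]
        · intro x hx
          have hxL : x ∉ L := fun h => hx (hLU h)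
          simp only [L, mem_ofPred_eq, not_forall] at hxL
          obtain ⟨V, hV, hxV, h⟩ := hxL
          refine ⟨V, mem_nhdsWithin_of_mem_nhds (hV.mem_nhds hxV), ?_⟩
          rw [← Ultrafilter.eventually_not] at h
          filter_upwards [h] with F hF
          exact not_nonempty_iff_eq_empty.1 hF
      filter_upwards [key] with F hF
      rwa [← disjoint_iff_inter_eq_empty, disjoint_compl_right_iff_subset] at hF
    have hne : L.Nonempty := by
      by_contra h
      obtain ⟨F, hF⟩ := (hsub ∅ isOpen_empty (not_nonempty_iff_eq_empty.1 h).subset).exists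
      exact F.nonempty'.ne_empty (subset_empty_iff.1 hF)
    refine ⟨⟨L, hLc, hne⟩, mem_univ _, ?_⟩
    rw [TopologicalSpace.nhds_generateFrom]
    simp only [le_iInf_iff, Filter.le_principal_iff]
    rintro s ⟨hs, ⟨U, hU, rfl⟩ | ⟨U, hU, rfl⟩⟩
    · exact hsub U hU hs
    · obtain ⟨x, hxL, hxU⟩ := hs
      exact hxL U hU hxU

/-- A point outside a closed set in the hyperspace has a closed neighbourhood outside it. -/
lemma exists_closed_nhds_notMem [NormalSpace X] {T : Set (Exp X)} (hT : IsClosed T)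
    {B : Exp X} (hB : B ∉ T) :
    ∃ (B' : Exp X) (U : Set X), IsOpen U ∧ B.carrier ⊆ U ∧ U ⊆ B'.carrier ∧ B' ∉ T := by
  let g : Set X → Exp X := fun s =>
    ⟨closure (B.carrier ∪ s), isClosed_closure, (B.nonempty'.mono subset_union_left).closure⟩
  have hg : Filter.Tendsto g (𝓝ˢ B.carrier).smallSets (𝓝 B) := by
    rw [TopologicalSpace.tendsto_nhds_generateFrom_iff]
    rintro s (⟨U, hU, rfl⟩ | ⟨U, hU, rfl⟩) hs
    · obtain ⟨V, hV, hBV, hVU⟩ := normal_exists_closure_subset B.isClosed' hU hs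
      refine Filter.eventually_smallSets.2 ⟨V, hV.mem_nhdsSet.2 hBV, fun t ht => ?_⟩
      exact (closure_mono (union_subset hBV ht)).trans hVU
    · refine Filter.Eventually.of_forall fun t => ?_
      exact hs.mono (inter_subset_inter_left _ (subset_union_left.trans subset_closure))
  obtain ⟨s, hs, h⟩ := Filter.eventually_smallSets.1 (hg (hT.isOpen_compl.mem_nhds hB))
  obtain ⟨U, hU, hBU, hUs⟩ := mem_nhdsSet_iff_exists.1 hs
  exact ⟨g s, U, hU, hBU, (hUs.trans subset_union_right).trans subset_closure, h s subset_rfl⟩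

end Exp

section AmbiguousRepresentationLemmas

variable {X Y Z : Type*} [TopologicalSpace X] [TopologicalSpace Y] [TopologicalSpace Z]

lemma IsStrictAmbRep.isClosed [Nonempty Y] [NormalSpace Y] {R : Set (Exp X × Exp Y)}
    (hR : IsStrictAmbRep R) : IsClosed R := by
  obtain ⟨⟨hmono, -, hright⟩, hleft⟩ := hR
  rw [← isOpen_compl_iff, isOpen_iff_mem_nhds]
  rintro ⟨A, B⟩ hAB
  obtain ⟨B', U, hU, hBU, hUB', hB'⟩ := Exp.exists_closed_nhds_notMem (hright A) hAB
  refine Filter.mem_of_superset (prod_mem_nhds ((hleft B').isOpen_compl.mem_nhds hB')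
    ((Exp.isOpen_subset hU).mem_nhds hBU)) ?_
  rintro ⟨A₁, B₁⟩ ⟨h₁, h₂⟩ h
  exact h₁ (hmono A₁ A₁ B₁ B' h subset_rfl (h₂.trans hUB'))

lemma IsStrictAmbRep.rcomp [Nonempty Y] [CompactSpace Y] [T2Space Y] [Nonempty Z] [NormalSpace Z]
    {R : Set (Exp X × Exp Y)} {S : Set (Exp Y × Exp Z)}
    (hR : IsStrictAmbRep R) (hS : IsStrictAmbRep S) : IsStrictAmbRep (rcomp R S) := by
  refine ⟨⟨?_, fun A => ⟨Exp.univ Y, hR.1.2.1 A, hS.1.2.1 _⟩, fun A => ?_⟩, fun C => ?_⟩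
  · rintro A A' C C' ⟨B, hAB, hBC⟩ hA hC
    exact ⟨B, hR.1.1 A A' B B hAB hA subset_rfl, hS.1.1 B B C C' hBC subset_rfl hC⟩
  · convert isClosedMap_snd_of_compactSpace _
      (hS.isClosed.inter ((hR.1.2.2 A).preimage continuous_fst)) using 1
    ext C
    exact ⟨fun ⟨B, h₁, h₂⟩ => ⟨(B, C), ⟨h₂, h₁⟩, rfl⟩,
      fun ⟨⟨B, C'⟩, ⟨h₂, h₁⟩, e⟩ => by subst e; exact ⟨B, h₁, h₂⟩⟩
  · convert isClosedMap_fst_of_compactSpace _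
      (hR.isClosed.inter ((hS.2 C).preimage continuous_snd)) using 1
    ext A
    exact ⟨fun ⟨B, h₁, h₂⟩ => ⟨(A, B), ⟨h₁, h₂⟩, rfl⟩,
      fun ⟨⟨A', B⟩, ⟨h₁, h₂⟩, e⟩ => by subst e; exact ⟨B, h₁, h₂⟩⟩

lemma IsOpenAmbRep.sms [Nonempty X] [Nonempty Y] {R : Set (Exp X × Exp Y)}
    (hR : IsOpenAmbRep R) : IsOpenAmbRep (sms R) :=
  ⟨hR.2.2, by rw [hR.2.1], by rw [hR.2.1]; exact hR.1⟩

/-- The pseudo-inverse of a composition is the composition of the pseudo-inverses in reverse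
order. -/
lemma IsOpenAmbRep.sms_rcomp [Nonempty X] [NormalSpace X] [Nonempty Y] [CompactSpace Y]
    [Nonempty Z] {R : Set (Exp X × Exp Y)} {S : Set (Exp Y × Exp Z)}
    (hR : IsOpenAmbRep R) (hS : IsOpenAmbRep S) :
    _root_.sms (_root_.rcomp R S) = _root_.rcomp (_root_.sms S) (_root_.sms R) := by
  ext ⟨C, A⟩
  constructor
  · intro h
    let ι := {G : Exp X // ∃ U : Set X, IsOpen U ∧ A.carrier ⊆ U ∧ U ⊆ G.carrier}
    let K : ι → Set (Exp Y) := fun G =>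
      {B | (C, B) ∈ _root_.sms S} ∩ {B | (B, G.1) ∈ _root_.sms R}
    have hKc : ∀ G, IsClosed (K G) := fun G => (hS.2.2.1.2.2 C).inter (hR.2.2.2 G.1)
    have : Nonempty ι := ⟨⟨Exp.univ X, Set.univ, isOpen_univ, subset_univ _, subset_rfl⟩⟩
    have hKd : Directed (· ⊇ ·) K := by
      rintro ⟨G₁, U₁, hU₁, hA₁, hG₁⟩ ⟨G₂, U₂, hU₂, hA₂, hG₂⟩
      refine ⟨⟨⟨G₁.carrier ∩ G₂.carrier, G₁.isClosed'.inter G₂.isClosed',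
        A.nonempty'.mono (subset_inter (hA₁.trans hG₁) (hA₂.trans hG₂))⟩,
        U₁ ∩ U₂, hU₁.inter hU₂, subset_inter hA₁ hA₂, inter_subset_inter hG₁ hG₂⟩, ?_, ?_⟩
      · exact fun B hB => ⟨hB.1, hR.2.2.1.1 _ _ _ _ hB.2 subset_rfl inter_subset_left⟩
      · exact fun B hB => ⟨hB.1, hR.2.2.1.1 _ _ _ _ hB.2 subset_rfl inter_subset_right⟩
    have hKn : ∀ G, (K G).Nonempty := by
      rintro ⟨G, U, hU, hAU, hUG⟩
      by_cases hne : (Uᶜ).Nonempty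
      · obtain ⟨D, ⟨B, hB, hBD⟩, hDC⟩ := h ⟨Uᶜ, hU.isClosed_compl, hne⟩
          (disjoint_iff_inter_eq_empty.1 (disjoint_compl_left_iff_subset.2 hAU))
        rw [← hS.2.1] at hBD
        obtain ⟨B', hB', hBB'⟩ := hBD C (by rwa [inter_comm])
        refine ⟨B', hB', fun A' hA' => ⟨B, hR.1.1.1 _ _ _ _ hB ?_ subset_rfl, by rwa [inter_comm]⟩⟩
        exact (disjoint_iff_inter_eq_empty.2 hA').subset_compl_right.trans (compl_subset_compl.2 hUG)
      · rw [not_nonempty_iff_eq_empty, compl_empty_iff] at hne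
        refine ⟨Exp.univ Y, hS.2.2.1.2.1 C, fun A' hA' => ?_⟩
        have hG : G.carrier = Set.univ := univ_subset_iff.1 (hne ▸ hUG)
        exact absurd (by simpa [hG] using hA') A'.nonempty'.ne_empty
    obtain ⟨B, hB⟩ := IsCompact.nonempty_iInter_of_directed_nonempty_isCompact_isClosed K hKd hKn
      (fun G => (hKc G).isCompact) hKc
    rw [mem_iInter] at hB
    refine ⟨B, (hB (Classical.arbitrary ι)).1, fun A' hA' => ?_⟩
    obtain ⟨V, hV, hAV, hVA'⟩ := normal_exists_closure_subset A.isClosed'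
      A'.isClosed'.isOpen_compl (disjoint_iff_inter_eq_empty.2 hA').subset_compl_left
    exact (hB ⟨⟨closure V, isClosed_closure, (A.nonempty'.mono hAV).closure⟩, V, hV, hAV,
      subset_closure⟩).2 A' (disjoint_iff_inter_eq_empty.1
        (subset_compl_iff_disjoint_left.1 hVA'))
  · rintro ⟨B, hCB, hBA⟩ A' hA'
    obtain ⟨B', hB', hdisj⟩ := hBA A' hA'
    obtain ⟨D, hD, hDC⟩ := hCB B' hdisj
    exact ⟨D, ⟨B', hB', hD⟩, hDC⟩

end AmbiguousRepresentationLemmas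

/-- The relational composition of open ambiguous representations is an open ambiguous
representation. -/
theorem statement12 {X Y Z : Type*}
    [TopologicalSpace X] [CompactSpace X] [T2Space X] [Nonempty X]
    [TopologicalSpace Y] [CompactSpace Y] [T2Space Y] [Nonempty Y]
    [TopologicalSpace Z] [CompactSpace Z] [T2Space Z] [Nonempty Z]
    (R : Set (Exp X × Exp Y)) (S : Set (Exp Y × Exp Z))
    (hR : IsOpenAmbRep R) (hS : IsOpenAmbRep S) :
    IsOpenAmbRep (rcomp R S) := by
  have h := hR.sms_rcomp hS
  refine ⟨hR.1.rcomp hS.1, ?_, h ▸ hS.2.2.rcomp hR.2.2⟩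
  rw [h, hS.sms.sms_rcomp hR.sms, hR.2.1, hS.2.1]
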